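/- Let G = (V, E) be a DAG with self-loops and G̃ its lifted graph. For every i ∈ V: the self-loop (i → i) belongs to E if and only if the vertices i₀ and i₁ are d-connected in G̃ given the conditioning set {k₀ : k ∈ pa(i) \ {i}} ∪ {k₁ : k ∈ pa(i) \ {i}}. (d-separation-oracle form of the loop-recovery phase of Theorem 1.) -/

import Mathlib

open Sum

/-- `G = (V, E)` is a DAG with self-loops: every directed cycle stays at a single
vertex, i.e., is a self-loop. -/
def IsDAGWithLoops {V : Type*} (E : V → V → Prop) : Prop :=
  ∀ (k : ℕ) (w : ℕ → V), 1 ≤ k → w k = w 0 →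
    (∀ l < k, E (w l) (w (l + 1))) → ∀ l ≤ k, w l = w 0

/-- The edge relation of the lifted graph `G̃` on `Ṽ = V₀ ⊔ V₁` (`inl i = i₀`,
`inr i = i₁`): `i₀ → i₁` for every self-loop `i → i`, and `i₀ → j₀`, `i₁ → j₁`,
`i₀ → j₁` for every edge `i → j` with `i ≠ j`. -/
def liftedEdge {V : Type*} (E : V → V → Prop) : V ⊕ V → V ⊕ V → Prop
  | .inl i, .inl j => i ≠ j ∧ E i j
  | .inl i, .inr j => (i = j ∧ E i i) ∨ (i ≠ j ∧ E i j)
  | .inr i, .inr j => i ≠ j ∧ E i j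
  | .inr _, .inl _ => False

/-- The parents of `j`: `pa(j) = {i : (i → j) ∈ E}`. -/
def parents {V : Type*} (E : V → V → Prop) (j : V) : Set V := {i | E i j}


/-- `v 0, …, v m` is a path between `a` and `b` in the directed graph with edge
relation `F`: at least one edge (`m ≥ 1`, i.e. at least two vertices), endpoints
`a` and `b`, pairwise distinct vertices, and consecutive vertices joined by an
edge in one direction or the other. -/
def IsPath {W : Type*} (F : W → W → Prop) (a b : W) (m : ℕ) (v : ℕ → W) : Prop :=
  1 ≤ m ∧ v 0 = a ∧ v m = b ∧
  (∀ l ≤ m, ∀ l' ≤ m, v l = v l' → l = l') ∧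
  (∀ l < m, F (v l) (v (l + 1)) ∨ F (v (l + 1)) (v l))

/-- The interior vertex `v l` is a collider on the path `v`. -/
def IsCollider {W : Type*} (F : W → W → Prop) (v : ℕ → W) (l : ℕ) : Prop :=
  F (v (l - 1)) (v l) ∧ F (v (l + 1)) (v l)

/-- The path `v 0, …, v m` is blocked by the conditioning set `C`: it contains an
interior non-collider vertex belonging to `C`, or an interior collider vertex
none of whose descendants (via `Relation.ReflTransGen F`) belongs to `C`. -/
def Blocked {W : Type*} (F : W → W → Prop) (C : Set W) (m : ℕ) (v : ℕ → W) : Prop :=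
  ∃ l, 0 < l ∧ l < m ∧
    ((¬ IsCollider F v l ∧ v l ∈ C) ∨
      (IsCollider F v l ∧ ∀ u, Relation.ReflTransGen F (v l) u → u ∉ C))

/-- `a` and `b` are d-separated given `C`: every path between them is blocked. -/
def DSep {W : Type*} (F : W → W → Prop) (a b : W) (C : Set W) : Prop :=
  ∀ (m : ℕ) (v : ℕ → W), IsPath F a b m v → Blocked F C m v

/-- The vertex sets `A` and `B` are d-separated given `C`. -/
def DSepSet {W : Type*} (F : W → W → Prop) (A B C : Set W) : Prop :=
  ∀ a ∈ A, ∀ b ∈ B, DSep F a b C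


theorem aux_seq {V : Type*} {E : V → V → Prop} {a b : V} (h : Relation.ReflTransGen E a b) :
    ∃ (k : ℕ) (w : ℕ → V), w 0 = a ∧ w k = b ∧ ∀ l < k, E (w l) (w (l + 1)) := by
  induction h with
  | refl => exact ⟨0, fun _ => a, rfl, rfl, by intro l hl; omega⟩
  | @tail b c _ hbc ih =>
    obtain ⟨k, w, h0, hk, hw⟩ := ih
    refine ⟨k + 1, fun l => if l ≤ k then w l else c, by simp [h0], by simp, ?_⟩
    intro l hl
    rcases Nat.lt_or_ge l k with h | h
    · have h1 : l ≤ k := by omega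
      have h2 : l + 1 ≤ k := by omega
      simp only [h1, h2, if_true]
      exact hw l h
    · have h1 : l = k := by omega
      subst h1
      simp [hk, hbc]

theorem aux_cycle {V : Type*} {E : V → V → Prop} (hG : IsDAGWithLoops E) {a b : V}
    (h : Relation.ReflTransGen E a b) (hba : E b a) : b = a := by
  obtain ⟨k, w, h0, hk, hw⟩ := aux_seq h
  have := hG (k + 1) (fun l => if l ≤ k then w l else a) (by omega) (by simp [h0]) (by
    intro l hl
    rcases Nat.lt_or_ge l k with h | h
    · have h1 : l ≤ k := by omega
      have h2 : l + 1 ≤ k := by omega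
      simp only [h1, h2, if_true]
      exact hw l h
    · have h1 : l = k := by omega
      subst h1
      simp [hk, hba]) k (by omega)
  simpa [h0, hk] using this

theorem aux_desc {V : Type*} {E : V → V → Prop} {a : V} {u : V ⊕ V}
    (h : Relation.ReflTransGen (liftedEdge E) (Sum.inr a) u) :
    ∃ b, u = Sum.inr b ∧ Relation.ReflTransGen E a b := by
  induction h with
  | refl => exact ⟨a, rfl, .refl⟩
  | @tail b c _ hbc ih =>
    obtain ⟨b', rfl, hb⟩ := ih
    rcases c with c | c
    · exact hbc.elim
    · exact ⟨c, rfl, hb.tail hbc.2⟩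

/-- d-separation-oracle form of the loop-recovery phase of
Theorem 1. The self-loop `(i → i)` belongs to `E` iff `i₀` and `i₁` are
d-connected in `G̃` given `{k₀ : k ∈ pa(i) \ {i}} ∪ {k₁ : k ∈ pa(i) \ {i}}`. -/
theorem loop_iff_dconnected {V : Type*} [Fintype V] (E : V → V → Prop)
    (hG : IsDAGWithLoops E) (i : V) :
    E i i ↔
      ¬ DSep (liftedEdge E) (Sum.inl i) (Sum.inr i)
        (Sum.inl '' (parents E i \ {i}) ∪ Sum.inr '' (parents E i \ {i})) := by
  constructor
  · intro hE hD
    obtain ⟨l, h1, h2, _⟩ := hD 1 (fun n => if n = 0 then Sum.inl i else Sum.inr i) (by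
      refine ⟨le_rfl, by simp, by simp, ?_, ?_⟩
      · intro l hl l' hl' h
        interval_cases l <;> interval_cases l' <;> simp_all
      · intro l hl
        interval_cases l
        left
        simp [liftedEdge, hE])
    omega
  · intro hD
    by_contra hE
    apply hD
    rintro m v ⟨hm, h0, hmv, -, hedge⟩
    by_contra hB
    obtain ⟨n, rfl⟩ : ∃ n, m = n + 1 := ⟨m - 1, by omega⟩
    have key : ∀ d ≤ n, Relation.ReflTransGen (liftedEdge E) (Sum.inr i) (v (n - d)) ∧
        liftedEdge E (v (n - d + 1)) (v (n - d)) := by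
      intro d
      induction d with
      | zero =>
        intro _
        have hF : liftedEdge E (v (n + 1)) (v n) := by
          rcases hedge n (by omega) with h | h
          · exfalso
            rw [hmv] at h
            rcases Nat.eq_zero_or_pos n with hn | hn
            · subst hn
              rw [h0] at h
              simp [liftedEdge, hE] at h
            · apply hB
              refine ⟨n, hn, by omega, Or.inl ⟨?_, ?_⟩⟩
              · rintro ⟨-, h2⟩
                rw [hmv] at h2
                rcases hv : v n with k | k
                · rw [hv] at h2
                  exact h2
                · rw [hv] at h h2
                  exact h.1 (aux_cycle hG (.single h2.2) h.2)
              · rcases hv : v n with k | k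
                · rw [hv] at h
                  rcases h with h | h
                  · exact absurd (h.1 ▸ h.2) hE
                  · exact Or.inl ⟨k, ⟨h.2, h.1⟩, rfl⟩
                · rw [hv] at h
                  exact Or.inr ⟨k, ⟨h.2, h.1⟩, rfl⟩
          · exact h
        exact ⟨.single (hmv ▸ hF), hF⟩
      | succ d ih =>
        intro hd
        obtain ⟨h1, h2⟩ := ih (by omega)
        obtain ⟨l, hl⟩ : ∃ l, n - d = l + 1 := ⟨n - d - 1, by omega⟩
        have hl' : n - (d + 1) = l := by omega
        rw [hl] at h1 h2
        rw [hl']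
        have hF : liftedEdge E (v (l + 1)) (v l) := by
          rcases hedge l (by omega) with h | h
          · exfalso
            apply hB
            refine ⟨l + 1, by omega, by omega, Or.inr ⟨⟨h, h2⟩, ?_⟩⟩
            intro u hu hC
            obtain ⟨b, rfl, hb⟩ := aux_desc (h1.trans hu)
            rcases hC with ⟨k, _, hk⟩ | ⟨k, ⟨hk1, hk2⟩, hk⟩
            · cases hk
            · cases hk
              exact hk2 (aux_cycle hG hb hk1)
          · exact h
        exact ⟨h1.tail hF, hF⟩
    have := (key n le_rfl).1
    rw [Nat.sub_self, h0] at this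
    obtain ⟨b, hb, _⟩ := aux_desc this
    cases hb
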